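/- arXiv:1403.6933 — 2 statements merged into one kernel-verified Lean document; each statement's English description precedes it below -/
import Mathlib

section
/- For every integer n ≥ 1, the number of ascent sequences of length n that avoid both of the patterns 0001 and 1012 equals the Catalan number C_n = (1/(n+1))·binom(2n,n). -/
/-- The number of ascents of a word of nonnegative integers. -/
def numAscents (w : List ℕ) : ℕ :=
  (w.zip w.tail).countP (fun p => p.1 < p.2)

/-- A word of nonnegative integers is an ascent sequence if it starts with 0 and
each subsequent entry is at most one more than the number of ascents preceding it. -/
def IsAscentSeq (w : List ℕ) : Prop :=
  w.head? = some 0 ∧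
    ∀ i (h : i < w.length), 1 ≤ i → w.get ⟨i, h⟩ ≤ numAscents (w.take i) + 1

/-- A word `π` contains the pattern `τ` if it has a subsequence order-isomorphic to `τ`. -/
def Contains (π τ : List ℕ) : Prop :=
  ∃ f : Fin τ.length → Fin π.length, StrictMono f ∧
    ∀ i j, (π.get (f i) < π.get (f j) ↔ τ.get i < τ.get j) ∧
      (π.get (f i) > π.get (f j) ↔ τ.get i > τ.get j)

/-- A word avoids a pattern if it does not contain it. -/
def Avoids (π τ : List ℕ) : Prop := ¬ Contains π τ

/-- The number of ascent sequences of length `n` avoiding every pattern in `T`. -/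
noncomputable def avoiderCount (n : ℕ) (T : List (List ℕ)) : ℕ :=
  {w : List ℕ | w.length = n ∧ IsAscentSeq w ∧ ∀ τ ∈ T, Avoids w τ}.ncard

/-- The transitions of the automaton that reads an avoiding word letter by letter.  A state
consists of a flag telling whether a new maximum is still allowed, and, for each admissible old
letter, a flag telling whether another copy of that letter bounds all subsequent letters.
The `i`-th entry of the list is the state reached by appending the letter `i`. -/
def avoidMoves (g : Bool) : List Bool → List (Bool × List Bool)
  | [] => if g then [(true, [false])] else []
  | false :: u =>
    (g, List.replicate (u.length + 1) true) :: (avoidMoves g u).map (fun s => (s.1, false :: s.2))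
  | true :: u => (false, [true]) :: (avoidMoves g u).map (fun s => (s.1, true :: s.2))

/-- The coefficients of `runValue`. -/
noncomputable def runCoeff (ρ : Bool → ℕ → PowerSeries ℤ) : ℕ → Bool × List Bool → ℤ
  | 0, s => PowerSeries.coeff 0 (ρ s.1 s.2.length)
  | n + 1, s => PowerSeries.coeff (n + 1) (ρ s.1 s.2.length) +
      ((avoidMoves s.1 s.2).map (runCoeff ρ n)).sum

/-- The sum over all runs of the automaton from the state `s`, where a run of length `a` that ends
with flag `g` and `t` admissible old letters has weight `X ^ a * ρ g t`. -/
noncomputable def runValue (ρ : Bool → ℕ → PowerSeries ℤ) (s : Bool × List Bool) : PowerSeries ℤ :=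
  PowerSeries.mk fun n => runCoeff ρ n s

namespace runValue

open PowerSeries

lemma coeff_list_sum {ι : Type*} (l : List ι) (f : ι → ℤ⟦X⟧) (n : ℕ) :
    coeff n (l.map f).sum = (l.map fun i => coeff n (f i)).sum := by
  induction l with
  | nil => simp
  | cons a l ih => simp [ih]

lemma eq_add (ρ : Bool → ℕ → ℤ⟦X⟧) (s : Bool × List Bool) :
    runValue ρ s = ρ s.1 s.2.length + X * ((avoidMoves s.1 s.2).map (runValue ρ)).sum := by
  ext n
  cases n with
  | zero => simp [runValue, runCoeff]
  | succ n =>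
    rw [map_add, coeff_succ_X_mul, coeff_list_sum]
    simp [runValue, runCoeff]

lemma eq_of_eq_add (ρ : Bool → ℕ → ℤ⟦X⟧) (h : Bool × List Bool → ℤ⟦X⟧)
    (hh : ∀ s, h s = ρ s.1 s.2.length + X * ((avoidMoves s.1 s.2).map h).sum)
    (s : Bool × List Bool) : runValue ρ s = h s := by
  ext n
  induction n generalizing s with
  | zero => rw [hh]; simp [runValue, runCoeff]
  | succ n ih =>
    rw [hh, eq_add, map_add, map_add, coeff_succ_X_mul, coeff_succ_X_mul, coeff_list_sum,
      coeff_list_sum]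
    simp only [ih]

lemma add (ρ σ : Bool → ℕ → ℤ⟦X⟧) (s : Bool × List Bool) :
    runValue (fun g t => ρ g t + σ g t) s = runValue ρ s + runValue σ s := by
  refine eq_of_eq_add _ (fun s => runValue ρ s + runValue σ s) (fun s => ?_) s
  rw [eq_add ρ, eq_add σ, List.sum_map_add]
  ring

lemma const_mul (a : ℤ⟦X⟧) (ρ : Bool → ℕ → ℤ⟦X⟧) (s : Bool × List Bool) :
    runValue (fun g t => a * ρ g t) s = a * runValue ρ s := by
  refine eq_of_eq_add _ (fun s => a * runValue ρ s) (fun s => ?_) s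
  rw [eq_add ρ, List.sum_map_mul_left]
  ring

lemma cons (ρ : Bool → ℕ → ℤ⟦X⟧) (b g : Bool) (u : List Bool) :
    runValue ρ (g, b :: u) = runValue (fun g t => ρ g (t + 1) + X * runValue ρ
      (if b then (false, [true]) else (g, List.replicate (t + 1) true))) (g, u) := by
  refine (eq_of_eq_add _ (fun s => runValue ρ (s.1, b :: s.2)) (fun s => ?_) (g, u)).symm
  rw [eq_add ρ]
  cases b <;> simp [avoidMoves, Function.comp_def] <;> ring

lemma replicate (ρ : Bool → ℕ → ℤ⟦X⟧) (g : Bool) (k : ℕ) :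
    runValue ρ (g, List.replicate k true) = runValue (fun g t => ρ g (t + k) +
      (runValue ρ (false, List.replicate k true) - ρ false k)) (g, []) := by
  induction k generalizing ρ with
  | zero =>
    have h : runValue ρ (false, []) = ρ false 0 := by rw [eq_add]; simp [avoidMoves]
    simp [h]
  | succ k ih =>
    rw [List.replicate_succ, cons, ih, ← cons]
    congr 1
    funext g t
    simp [add_assoc, ← List.replicate_succ]
    ring

lemma avoidMoves_replicate (k : ℕ) : avoidMoves false (List.replicate k true) =
    (List.range k).map fun j => (false, List.replicate (j + 1) true) := by
  induction k with
  | zero => simp [avoidMoves]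
  | succ k ih =>
    simp [List.replicate_succ, avoidMoves, ih, List.range_succ_eq_map, Function.comp_def]

lemma replicate_false_succ (ρ : Bool → ℕ → ℤ⟦X⟧) (k : ℕ) :
    (1 - X) * runValue ρ (false, List.replicate (k + 1) true) =
      runValue ρ (false, List.replicate k true) + (ρ false (k + 1) - ρ false k) := by
  have h1 := eq_add ρ (false, List.replicate (k + 1) true)
  have h0 := eq_add ρ (false, List.replicate k true)
  rw [avoidMoves_replicate] at h0 h1
  simp only [List.range_succ, List.map_append, List.sum_append, List.map_cons, List.map_nil,
    List.sum_singleton, List.length_replicate] at h0 h1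
  linear_combination h1 - h0

lemma replicate_false (ρ : Bool → ℕ → ℤ⟦X⟧) (y z : ℤ⟦X⟧) (hz : (1 - X) * z = 1)
    (hρ : ∀ t, ρ false t = y ^ t) (k : ℕ) :
    (y - 1 - X * y) * runValue ρ (false, List.replicate k true) =
      (y - 1) * y ^ k - X * y * z ^ k := by
  induction k with
  | zero =>
    have h : runValue ρ (false, []) = ρ false 0 := by rw [eq_add]; simp [avoidMoves]
    simp [h, hρ]
  | succ k ih =>
    have h := replicate_false_succ ρ k
    rw [hρ, hρ] at h
    have hk : runValue ρ (false, List.replicate (k + 1) true) =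
        z * (runValue ρ (false, List.replicate k true) + (y ^ (k + 1) - y ^ k)) := by
      rw [← h]
      linear_combination -hz * runValue ρ (false, List.replicate (k + 1) true)
    rw [hk]
    linear_combination z * ih + y ^ (k + 1) * (y - 1) * hz

/-- Runs from the empty word, weighted by `y ^ t` where new maxima are still allowed. -/
noncomputable def growing (y : ℤ⟦X⟧) : ℤ⟦X⟧ := runValue (fun g t => if g then y ^ t else 0) (true, [])

/-- Runs from the empty word, weighted by `y ^ t` where no new maximum is allowed. -/
noncomputable def bounded (y : ℤ⟦X⟧) : ℤ⟦X⟧ := runValue (fun g t => if g then 0 else y ^ t) (true, [])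

/-- All runs from the empty word. -/
noncomputable def total : ℤ⟦X⟧ := runValue (fun _ _ => 1) (true, [])

lemma nil_eq (ρ : Bool → ℕ → ℤ⟦X⟧) : runValue ρ (true, []) = ρ true 0 + X * runValue
    (fun g t => ρ g (t + 1) + X * runValue ρ (g, List.replicate (t + 1) true)) (true, []) := by
  have h := cons ρ false true []
  simp only [Bool.false_eq_true, if_false] at h
  rw [← h, eq_add]
  simp [avoidMoves]

lemma total_eq_growing_add_bounded : total = growing 1 + bounded 1 := by
  rw [total, growing, bounded, ← add]
  congr 1
  funext g t
  cases g <;> simp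

lemma eq_linear (ρ : Bool → ℕ → ℤ⟦X⟧) (y z a b c d : ℤ⟦X⟧)
    (h1 : ∀ t, ρ true t = a * y ^ t + b * z ^ t) (h0 : ∀ t, ρ false t = c * y ^ t + d * z ^ t) :
    runValue ρ (true, []) = a * growing y + b * growing z + c * bounded y + d * bounded z := by
  rw [growing, growing, bounded, bounded, ← const_mul, ← const_mul, ← const_mul, ← const_mul,
    ← add, ← add, ← add]
  congr 1
  funext g t
  cases g <;> simp [h1, h0]

lemma growing_eq (y : ℤ⟦X⟧) :
    growing y = 1 + X * y * growing y + X ^ 2 * y * growing y ^ 2 := by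
  have hF (k : ℕ) : runValue (fun g t => if g then y ^ t else 0) (false, List.replicate k true)
      = 0 := by
    induction k with
    | zero => rw [eq_add]; simp [avoidMoves]
    | succ k ih =>
      have h := replicate_false_succ (fun g t => if g then y ^ t else 0) k
      rw [ih] at h
      have : (1 - X : ℤ⟦X⟧) ≠ 0 := fun h => by simpa using congrArg (coeff 0) h
      simpa [this] using h
  have hT (k : ℕ) : runValue (fun g t => if g then y ^ t else 0) (true, List.replicate k true)
      = y ^ k * growing y := by
    rw [replicate, hF, eq_linear _ y 0 (y ^ k) 0 0 0]
    · ring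
    · intro t; simp; ring
    · intro t; simp
  have h := nil_eq (fun g t => if g then y ^ t else 0)
  rw [eq_linear (fun g t => (if g then y ^ (t + 1) else 0) + X * runValue
    (fun g t => if g then y ^ t else 0) (g, List.replicate (t + 1) true))
    y 0 (y + X * y * growing y) 0 0 0 (fun t => by rw [hT, if_pos rfl]; ring)
    (fun t => by rw [hF]; simp), ← growing, if_pos rfl] at h
  linear_combination h

lemma bounded_eq (y z : ℤ⟦X⟧) (hz : (1 - X) * z = 1) :
    (y - 1 - X * y) * bounded y = X ^ 2 * ((y - 1 - X * y) * y * bounded y * growing y +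
      total * (X * y * (y * growing y) - X * y * (z * growing z))) +
      X * y * (y - 1 - X * y) * bounded y +
      X ^ 2 * ((y - 1) * y * bounded y - X * y * z * bounded z) := by
  set ρ : Bool → ℕ → ℤ⟦X⟧ := fun g t => if g then 0 else y ^ t with hρ
  have hF := replicate_false ρ y z hz (fun t => by simp [hρ])
  have hT (k : ℕ) : runValue ρ (true, List.replicate k true) = y ^ k * bounded y +
      (runValue ρ (false, List.replicate k true) - y ^ k) * total := by
    rw [replicate, bounded, total, ← const_mul, ← const_mul, ← add]
    congr 1
    funext g t
    cases g <;> simp [hρ]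
    ring
  have h := nil_eq ρ
  set d := y - 1 - X * y with hd
  have h2 := eq_linear (fun g t => d * (ρ g (t + 1) + X * runValue ρ
    (g, List.replicate (t + 1) true))) y z (X * (d * y * bounded y + total * (X * y * y)))
    (X * (- total * (X * y * z))) (d * y + X * (y - 1) * y) (- X * (X * y * z))
    (fun t => by
      simp only [hT]
      have := hF (t + 1)
      simp [hρ] at this ⊢
      linear_combination X * total * this)
    (fun t => by
      have := hF (t + 1)
      simp [hρ] at this ⊢
      linear_combination X * this)
  rw [const_mul] at h2
  have hb : runValue ρ (true, []) = bounded y := rfl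
  rw [hb] at h
  have h0 : ρ true 0 = 0 := by simp [hρ]
  rw [h0] at h
  linear_combination d * h + X * h2

lemma total_eq (z : ℤ⟦X⟧) (hz : (1 - X) * z = 1) :
    total = 1 + X * total + X ^ 2 * z * (total * growing z + bounded z) := by
  have hF (k : ℕ) : runValue (fun _ _ => 1) (false, List.replicate k true) = z ^ k := by
    have := replicate_false (fun _ _ => 1) 1 z hz (by simp) k
    have hX : (X : ℤ⟦X⟧) ≠ 0 := X_ne_zero
    simpa [hX] using this
  have hT (k : ℕ) : runValue (fun _ _ => 1) (true, List.replicate k true) =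
      total + (z ^ k - 1) * total := by
    rw [replicate, hF, total, ← const_mul, ← add]
    congr 1
    funext g t
    ring
  have h := nil_eq (fun _ _ => 1)
  rw [← total, eq_linear (fun g t => 1 + X * runValue (fun _ _ => 1) (g, List.replicate (t + 1) true))
    1 z 1 (X * z * total) 1 (X * z) (fun t => by rw [hT]; ring) (fun t => by rw [hF]; ring)] at h
  linear_combination h - X * total_eq_growing_add_bounded

/-- The substitution `y = 1 + X * C`, with `C` the Catalan series, is the root of the kernel. -/
theorem total_eq_catalan : total = PowerSeries.mk fun n => (catalan n : ℤ) := by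
  set C : ℤ⟦X⟧ := PowerSeries.mk fun n => (catalan n : ℤ) with hC
  have hcat : C = 1 + X * C ^ 2 := by
    have h := congrArg (PowerSeries.map (Nat.castRingHom ℤ)) catalanSeries_sq_mul_X_add_one
    have hmap : PowerSeries.map (Nat.castRingHom ℤ) catalanSeries = C := by
      ext n; simp [hC]
    simp only [map_add, map_mul, map_pow, hmap, map_one, PowerSeries.map_X] at h
    linear_combination -h
  obtain ⟨z, hz⟩ : ∃ z : ℤ⟦X⟧, (1 - X) * z = 1 :=
    ⟨_, by rw [mul_comm]; exact PowerSeries.mk_one_mul_one_sub_eq_one ℤ⟩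
  have hy0 : constantCoeff (1 + X * C) = (1 : ℤ) := by simp
  set p := growing (1 + X * C) with hp
  have ne_of_coeff {a : ℤ⟦X⟧} (h : constantCoeff a = 1) : a ≠ 0 := by
    rintro rfl; simp at h
  have hpC : (1 + X * C) * p = C ^ 2 := by
    have hpe := growing_eq (1 + X * C)
    rw [← hp] at hpe
    have : ((1 + X * C) * p - C ^ 2) *
        (1 - X * (1 + X * C) - X ^ 2 * ((1 + X * C) * p + C ^ 2)) = 0 := by
      linear_combination (1 + X * C) * hpe - (1 + C + X * C + X * C ^ 2) * hcat
    refine sub_eq_zero.1 ((mul_eq_zero.1 this).resolve_right (ne_of_coeff (by simp)))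
  have hb := bounded_eq (1 + X * C) z hz
  have ht := total_eq z hz
  obtain ⟨s, hs⟩ : ∃ s, s = total * growing z + bounded z := ⟨_, rfl⟩
  have hd : 1 + X * C - 1 - X * (1 + X * C) = X ^ 3 * C ^ 3 := by
    linear_combination (X + X ^ 2 * C) * hcat
  rw [← hp, hd] at hb
  rw [← hs] at ht
  have hker : X ^ 3 * (1 + X * C) * (C ^ 2 * total - z * s) = 0 := by
    linear_combination -hb - X ^ 3 * (1 + X * C) * z * hs - X ^ 3 * (1 + X * C) * total * hpC -
      X ^ 2 * (X ^ 3 * C ^ 3) * bounded (1 + X * C) * hpC +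
      bounded (1 + X * C) * X ^ 3 * C * (1 + C + X * C + X * C ^ 2) * hcat
  have hzs : C ^ 2 * total = z * s := by
    refine sub_eq_zero.1 ((mul_eq_zero.1 hker).resolve_left ?_)
    exact mul_ne_zero (pow_ne_zero _ X_ne_zero) (ne_of_coeff hy0)
  have hfin : (total - C) * (1 - X * C) = 0 := by
    linear_combination ht - X ^ 2 * hzs - (1 + total * X) * hcat
  exact sub_eq_zero.1 ((mul_eq_zero.1 hfin).resolve_right (ne_of_coeff (by simp)))

end runValue

open scoped List

lemma sublist_snoc_iff {α : Type*} {l w : List α} {a x : α} :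
    l ++ [a] <+ w ++ [x] ↔ l ++ [a] <+ w ∨ a = x ∧ l <+ w := by
  rw [← List.reverse_sublist, ← List.reverse_sublist (l₁ := l ++ [a]),
    ← List.reverse_sublist (l₁ := l)]
  simp only [List.reverse_append, List.reverse_singleton, List.singleton_append]
  exact List.cons_sublist_cons'

lemma numAscents_snoc (w : List ℕ) (y x : ℕ) :
    numAscents (w ++ [y] ++ [x]) = numAscents (w ++ [y]) + if y < x then 1 else 0 := by
  induction w with
  | nil => simp [numAscents]
  | cons a w ih =>
    cases w with
    | nil => simp [numAscents, List.countP_cons]; omega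
    | cons b w => simp [numAscents, List.countP_cons] at ih ⊢; omega

lemma isAscentSeq_snoc {w : List ℕ} (hw : w ≠ []) (x : ℕ) :
    IsAscentSeq (w ++ [x]) ↔ IsAscentSeq w ∧ x ≤ numAscents w + 1 := by
  have hpos : 1 ≤ w.length := List.length_pos_iff.2 hw
  have htake (i : ℕ) (hi : i ≤ w.length) : (w ++ [x]).take i = w.take i :=
    List.take_append_of_le_length hi
  unfold IsAscentSeq
  constructor
  · rintro ⟨h0, h⟩
    refine ⟨⟨by rwa [List.head?_append_of_ne_nil w hw] at h0, fun i hi h1 => ?_⟩, ?_⟩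
    · have := h i (by simp; omega) h1
      rw [htake i hi.le] at this
      simpa [List.getElem_append_left hi] using this
    · have := h w.length (by simp) hpos
      simpa using this
  · rintro ⟨⟨h0, h⟩, hx⟩
    refine ⟨by simp [List.head?_append, h0], fun i hi h1 => ?_⟩
    rcases lt_or_ge i w.length with hi' | hi'
    · rw [htake i hi'.le]
      simpa [List.getElem_append_left hi'] using h i hi' h1
    · obtain rfl : i = w.length := by simp at hi; omega
      simpa using hx

lemma contains_of_sublist {π τ l : List ℕ} (hlen : l.length = τ.length) (h : l <+ π)
    (hl : ∀ (i j : ℕ) (hi : i < τ.length) (hj : j < τ.length), l[i] < l[j] ↔ τ[i] < τ[j]) :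
    Contains π τ := by
  obtain ⟨f, hf⟩ := List.sublist_iff_exists_fin_orderEmbedding_get_eq.1 h
  refine ⟨fun i => f (i.cast hlen.symm), fun i j hij => f.strictMono (by simpa using hij), ?_⟩
  intro i j
  rw [← hf, ← hf]
  exact ⟨hl i j i.2 j.2, hl j i j.2 i.2⟩

lemma exists_sublist_of_contains {π τ : List ℕ} (h : Contains π τ) :
    ∃ (l : List ℕ) (hlen : l.length = τ.length), l <+ π ∧
      ∀ (i j : ℕ) (hi : i < τ.length) (hj : j < τ.length), l[i] < l[j] ↔ τ[i] < τ[j] := by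
  obtain ⟨f, hf, h⟩ := h
  refine ⟨List.ofFn fun i => π.get (f i), by simp, ?_, fun i j hi hj => ?_⟩
  · rw [List.sublist_iff_exists_fin_orderEmbedding_get_eq]
    refine ⟨OrderEmbedding.ofStrictMono (fun i => f (i.cast (by simp)))
      (fun i j hij => hf (by simpa using hij)), fun i => by simp; rfl⟩
  · simpa using (h ⟨i, hi⟩ ⟨j, hj⟩).1

lemma avoids_iff (w : List ℕ) : (∀ τ ∈ [[0, 0, 0, 1], [1, 0, 1, 2]], Avoids w τ) ↔
    ∀ a b c, a ≤ b → b < c → ¬ [b, a, b, c] <+ w := by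
  constructor
  · intro h a b c hab hbc hs
    rcases hab.eq_or_lt with rfl | hab
    · refine h [0, 0, 0, 1] (by simp) (contains_of_sublist (l := [a, a, a, c]) rfl hs ?_)
      intro i j hi hj
      simp only [List.length_cons, List.length_nil] at hi hj
      interval_cases i <;> interval_cases j <;> simp <;> omega
    · refine h [1, 0, 1, 2] (by simp) (contains_of_sublist (l := [b, a, b, c]) rfl hs ?_)
      intro i j hi hj
      simp only [List.length_cons, List.length_nil] at hi hj
      interval_cases i <;> interval_cases j <;> simp <;> omega
  · intro h τ hτ hc
    obtain ⟨l, hlen, hs, hl⟩ := exists_sublist_of_contains hc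
    simp only [List.mem_cons, List.not_mem_nil, or_false] at hτ
    rcases hτ with rfl | rfl
    all_goals
      obtain ⟨p, q, r, t, rfl⟩ := List.length_eq_four.1 hlen
      have h01 := hl 0 1 (by simp) (by simp)
      have h10 := hl 1 0 (by simp) (by simp)
      have h02 := hl 0 2 (by simp) (by simp)
      have h20 := hl 2 0 (by simp) (by simp)
      have h03 := hl 0 3 (by simp) (by simp)
      simp at h01 h10 h02 h20 h03
      obtain rfl : r = p := by omega
      exact h q r t (by omega) h03 hs

/-- Reading another copy of `i` after `w` completes an occurrence of `000` or `101`. -/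
def LetterClosed (w : List ℕ) (i : ℕ) : Prop := ∃ a ≤ i, [i, a] <+ w

/-- No letter larger than `b` may follow `w`, because of a pattern `000` or `101`. -/
def LetterBounding (w : List ℕ) (b : ℕ) : Prop := ∃ a ≤ b, [b, a, b] <+ w

/-- Ascent sequences that avoid both patterns. -/
def IsGoodWord (w : List ℕ) : Prop :=
  IsAscentSeq w ∧ ∀ a b c, a ≤ b → b < c → ¬ [b, a, b, c] <+ w

lemma letterClosed_snoc (w : List ℕ) (x i : ℕ) :
    LetterClosed (w ++ [x]) i ↔ LetterClosed w i ∨ x ≤ i ∧ i ∈ w := by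
  have h (a : ℕ) : [i, a] <+ w ++ [x] ↔ [i, a] <+ w ∨ a = x ∧ i ∈ w := by
    simpa using sublist_snoc_iff (l := [i]) (a := a) (x := x) (w := w)
  simp only [LetterClosed, h]
  grind

lemma letterBounding_snoc (w : List ℕ) (x b : ℕ) :
    LetterBounding (w ++ [x]) b ↔ LetterBounding w b ∨ b = x ∧ LetterClosed w b := by
  have h (a : ℕ) : [b, a, b] <+ w ++ [x] ↔ [b, a, b] <+ w ∨ b = x ∧ [b, a] <+ w := by
    simpa using sublist_snoc_iff (l := [b, a]) (a := b) (x := x) (w := w)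
  simp only [LetterBounding, LetterClosed, h]
  constructor
  · rintro ⟨a, ha, hs | ⟨rfl, hs⟩⟩
    · exact Or.inl ⟨a, ha, hs⟩
    · exact Or.inr ⟨rfl, a, ha, hs⟩
  · rintro (⟨a, ha, hs⟩ | ⟨rfl, a, ha, hs⟩)
    · exact ⟨a, ha, Or.inl hs⟩
    · exact ⟨a, ha, Or.inr ⟨rfl, hs⟩⟩

lemma LetterClosed.mem {w : List ℕ} {b : ℕ} (h : LetterClosed w b) : b ∈ w := by
  obtain ⟨a, ha, h⟩ := h
  exact h.subset (by simp)

lemma isGoodWord_snoc {w : List ℕ} (hw : w ≠ []) (x : ℕ) : IsGoodWord (w ++ [x]) ↔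
    IsGoodWord w ∧ x ≤ numAscents w + 1 ∧ ∀ b < x, ¬ LetterBounding w b := by
  have h (a b c : ℕ) : [b, a, b, c] <+ w ++ [x] ↔ [b, a, b, c] <+ w ∨ c = x ∧ [b, a, b] <+ w := by
    simpa using sublist_snoc_iff (l := [b, a, b]) (a := c) (x := x) (w := w)
  simp only [IsGoodWord, isAscentSeq_snoc hw, h, LetterBounding]
  grind

lemma length_avoidMoves (g : Bool) (u : List Bool) :
    (avoidMoves g u).length = u.length + if g then 1 else 0 := by
  induction u with
  | nil => cases g <;> simp [avoidMoves]
  | cons b u ih => cases b <;> simp [avoidMoves, ih] <;> omega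

lemma getElem_avoidMoves (g : Bool) (u : List Bool) (x : ℕ) (hx : x < (avoidMoves g u).length) :
    (avoidMoves g u)[x] = if h : x < u.length then
      if u[x] then (false, u.take (x + 1))
        else (g, u.take x ++ List.replicate (u.length - x) true)
      else (true, u ++ [false]) := by
  induction u generalizing x with
  | nil => cases g <;> simp [avoidMoves] at hx ⊢
  | cons b u ih =>
    cases x with
    | zero => cases b <;> simp [avoidMoves]
    | succ x =>
      have hx' : x < (avoidMoves g u).length := by
        cases b <;> simpa [avoidMoves] using hx
      cases b <;> simp [avoidMoves, ih x hx'] <;> split_ifs <;> simp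

/-- The state `(g, u)` describes the nonempty word `w`. -/
structure TracksWord (w : List ℕ) (g : Bool) (u : List Bool) : Prop where
  ne_nil : u ≠ []
  mem : ∀ i < u.length, i ∈ w
  closed : ∀ (i : ℕ) (h : i < u.length), u[i] = true ↔ LetterClosed w i
  not_bounding : ∀ b, b + 1 < u.length → ¬ LetterBounding w b
  le_numAscents : u.length ≤ numAscents w + 1
  lt_of_growing : g = true → ∀ i ∈ w, i < u.length
  not_bounding_of_growing : g = true → ∀ b, ¬ LetterBounding w b
  numAscents_of_growing : g = true → numAscents w + 1 = u.length
  bounding : g = false → LetterBounding w (u.length - 1)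

namespace TracksWord

variable {w : List ℕ} {g : Bool} {u : List Bool}

lemma word_ne_nil (h : TracksWord w g u) : w ≠ [] :=
  List.ne_nil_of_mem (h.mem 0 (List.length_pos_iff.2 h.ne_nil))

lemma isGoodWord_snoc_iff (h : TracksWord w g u) (hw : IsGoodWord w) (x : ℕ) :
    IsGoodWord (w ++ [x]) ↔ x < (avoidMoves g u).length := by
  have hpos := List.length_pos_iff.2 h.ne_nil
  rw [isGoodWord_snoc h.word_ne_nil, length_avoidMoves]
  have hle := h.le_numAscents
  cases g with
  | true =>
    have := h.numAscents_of_growing rfl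
    simp only [hw, h.not_bounding_of_growing rfl, not_false_iff, implies_true, and_true, true_and,
      if_true]
    omega
  | false =>
    simp only [hw, true_and, Bool.false_eq_true, if_false, add_zero]
    constructor
    · rintro ⟨-, hb⟩
      by_contra hx
      exact hb (u.length - 1) (by omega) (h.bounding rfl)
    · exact fun hx => ⟨by omega, fun b hb => h.not_bounding b (by omega)⟩

lemma numAscents_le_snoc (w : List ℕ) (x : ℕ) : numAscents w ≤ numAscents (w ++ [x]) := by
  rcases w.eq_nil_or_concat' with rfl | ⟨v, y, rfl⟩
  · simp [numAscents]
  · rw [numAscents_snoc]; omega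

lemma snoc_new (h : TracksWord w true u) :
    TracksWord (w ++ [u.length]) true (u ++ [false]) := by
  have hasc : numAscents (w ++ [u.length]) = numAscents w + 1 := by
    obtain ⟨v, y, rfl⟩ := w.eq_nil_or_concat'.resolve_left h.word_ne_nil
    rw [numAscents_snoc, if_pos (h.lt_of_growing rfl y (by simp))]
  have hlt := h.lt_of_growing rfl
  have hnum := h.numAscents_of_growing rfl
  have hnb : ∀ b, ¬ LetterBounding (w ++ [u.length]) b := by
    intro b
    rw [letterBounding_snoc]
    rintro (hb | ⟨rfl, hb⟩)
    · exact h.not_bounding_of_growing rfl b hb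
    · exact (hlt _ hb.mem).false
  refine ⟨by simp, fun i hi => ?_, fun i hi => ?_, fun b _ => hnb b, by simp; omega,
    fun _ i hi => ?_, fun _ => hnb, fun _ => by simp; omega, by simp⟩
  · simp only [List.length_append, List.length_singleton] at hi
    rcases (Nat.lt_succ_iff_lt_or_eq.1 hi) with hi | rfl
    · simp [h.mem i hi]
    · simp
  · simp only [List.length_append, List.length_singleton] at hi
    rw [letterClosed_snoc]
    rcases (Nat.lt_succ_iff_lt_or_eq.1 hi) with hi | rfl
    · rw [List.getElem_append_left hi, h.closed i hi]
      simp [hi]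
    · simp only [List.getElem_concat_length, Bool.false_eq_true, false_iff, not_or]
      exact ⟨fun hc => (hlt _ hc.mem).false, fun hc => (hlt _ hc.2).false⟩
  · simp only [List.mem_append, List.mem_singleton] at hi
    simp only [List.length_append, List.length_singleton]
    rcases hi with hi | rfl
    · exact (hlt i hi).trans (Nat.lt_succ_self _)
    · exact Nat.lt_succ_self _

lemma snoc_closed (h : TracksWord w g u) {x : ℕ} (hx : x < u.length) (hux : u[x] = true) :
    TracksWord (w ++ [x]) false (u.take (x + 1)) := by
  have hlen : (u.take (x + 1)).length = x + 1 := by simp; omega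
  have hc := (h.closed x hx).1 hux
  have hasc := numAscents_le_snoc w x
  have hle := h.le_numAscents
  refine ⟨fun h0 => by simp [h0] at hlen, fun i hi => ?_, fun i hi => ?_, fun b hb => ?_, by omega,
    by simp, by simp, by simp, fun _ => ?_⟩
  · simp [h.mem i (by omega)]
  · rw [List.getElem_take, h.closed i (by omega), letterClosed_snoc]
    refine ⟨Or.inl, ?_⟩
    rintro (hi' | ⟨hxi, -⟩)
    · exact hi'
    · obtain rfl : i = x := by omega
      exact hc
  · rw [letterBounding_snoc]
    rintro (hb' | ⟨rfl, -⟩)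
    · exact h.not_bounding b (by omega) hb'
    · omega
  · rw [hlen, letterBounding_snoc]
    exact Or.inr ⟨rfl, hc⟩

lemma snoc_open (h : TracksWord w g u) {x : ℕ} (hx : x < u.length) (hux : u[x] = false) :
    TracksWord (w ++ [x]) g (u.take x ++ List.replicate (u.length - x) true) := by
  have hlen : (u.take x ++ List.replicate (u.length - x) true).length = u.length := by
    simp; omega
  have hc : ¬ LetterClosed w x := by rw [← h.closed x hx, hux]; simp
  have hbd (b : ℕ) : LetterBounding (w ++ [x]) b ↔ LetterBounding w b := by
    rw [letterBounding_snoc]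
    refine ⟨?_, Or.inl⟩
    rintro (hb | ⟨rfl, hb⟩)
    · exact hb
    · exact absurd hb hc
  have hle := h.le_numAscents
  have hasc := numAscents_le_snoc w x
  refine ⟨fun h0 => ?_, fun i hi => ?_, fun i hi => ?_, fun b hb => ?_, by omega,
    fun hg i hi => ?_, fun hg b => ?_, fun hg => ?_, fun hg => ?_⟩
  · simp [h0] at hlen; omega
  · simp [h.mem i (by omega)]
  · rw [letterClosed_snoc]
    rcases lt_or_ge i x with hix | hix
    · rw [List.getElem_append_left (by simp; omega), List.getElem_take, h.closed i (by omega)]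
      simp [hix]
    · rw [List.getElem_append_right (by simp; omega)]
      simp [hix, h.mem i (by omega)]
  · rw [hbd]; exact h.not_bounding b (by omega)
  · rw [hlen]
    rcases List.mem_append.1 hi with hi | hi
    · exact h.lt_of_growing hg i hi
    · simp at hi; omega
  · rw [hbd]; exact h.not_bounding_of_growing hg b
  · rw [hlen, ← h.numAscents_of_growing hg]
    obtain ⟨v, y, rfl⟩ := w.eq_nil_or_concat'.resolve_left h.word_ne_nil
    rw [numAscents_snoc, if_neg, add_zero]
    intro hyx
    have hxv : x ∈ v := by
      have := h.mem x hx
      simp at this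
      rcases this with h | h
      · exact h
      · omega
    exact hc ((letterClosed_snoc v y x).2 (Or.inr ⟨hyx.le, hxv⟩))
  · rw [hlen, hbd]; exact h.bounding hg

lemma snoc (h : TracksWord w g u) (x : ℕ) (hx : x < (avoidMoves g u).length) :
    TracksWord (w ++ [x]) (avoidMoves g u)[x].1 (avoidMoves g u)[x].2 := by
  rw [getElem_avoidMoves]
  split_ifs with hxu hc
  · exact h.snoc_closed hxu hc
  · exact h.snoc_open hxu (by simpa using hc)
  · rw [length_avoidMoves] at hx
    cases g with
    | true =>
      obtain rfl : x = u.length := by simp at hx; omega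
      exact h.snoc_new
    | false => simp at hx; omega

end TracksWord

/-- The words of length `n` accepted by the automaton from the state `s`. -/
def avoidWords : ℕ → Bool × List Bool → Finset (List ℕ)
  | 0, _ => {[]}
  | n + 1, s => Finset.univ.biUnion fun x : Fin (avoidMoves s.1 s.2).length =>
      (avoidWords n (avoidMoves s.1 s.2)[x]).image (List.cons x.1)

lemma card_avoidWords (n : ℕ) (s : Bool × List Bool) :
    ((avoidWords n s).card : ℤ) = runCoeff (fun _ _ => 1) n s := by
  induction n generalizing s with
  | zero => simp [avoidWords, runCoeff]
  | succ n ih =>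
    rw [avoidWords, Finset.card_biUnion]
    · simp only [Finset.card_image_of_injective _ List.cons_injective, Nat.cast_sum, ih, runCoeff]
      simp only [Fin.getElem_fin]
      rw [Fin.sum_univ_fun_getElem _ (runCoeff (fun _ _ => 1) n)]
      simp [PowerSeries.coeff_one]
    · intro x _ y _ hxy
      rw [Function.onFun, Finset.disjoint_left]
      intro v hv hv'
      obtain ⟨v, -, rfl⟩ := Finset.mem_image.1 hv
      obtain ⟨v', -, h⟩ := Finset.mem_image.1 hv'
      exact hxy (Fin.ext (List.cons.inj h).1.symm)

lemma isGoodWord_of_append {w v : List ℕ} (hw : w ≠ []) (h : IsGoodWord (w ++ v)) :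
    IsGoodWord w := by
  induction v using List.reverseRecOn with
  | nil => simpa using h
  | append_singleton v x ih =>
    rw [← List.append_assoc, isGoodWord_snoc (by simp [hw])] at h
    exact ih h.1

lemma mem_avoidWords {w : List ℕ} {g : Bool} {u : List Bool} (h : TracksWord w g u)
    (hw : IsGoodWord w) (n : ℕ) (v : List ℕ) :
    v ∈ avoidWords n (g, u) ↔ v.length = n ∧ IsGoodWord (w ++ v) := by
  induction n generalizing w g u v with
  | zero =>
    simp only [avoidWords, Finset.mem_singleton, List.length_eq_zero_iff]
    exact ⟨fun hv => ⟨hv, by simpa [hv] using hw⟩, And.left⟩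
  | succ n ih =>
    simp only [avoidWords, Finset.mem_biUnion, Finset.mem_univ, true_and, Finset.mem_image]
    constructor
    · rintro ⟨x, v, hv, rfl⟩
      have := (ih (h.snoc x x.2) ((h.isGoodWord_snoc_iff hw x).2 x.2) v).1 hv
      simpa using this
    · rintro ⟨hlen, hv⟩
      obtain ⟨x, v, rfl⟩ := List.exists_cons_of_length_eq_add_one hlen
      have hv' : IsGoodWord (w ++ [x] ++ v) := by simpa using hv
      have hx := isGoodWord_of_append (by simp) hv'
      have hxl := (h.isGoodWord_snoc_iff hw x).1 hx
      exact ⟨⟨x, hxl⟩, v, (ih (h.snoc x hxl) hx v).2 ⟨by simpa using hlen, hv'⟩, rfl⟩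

lemma isGoodWord_zero : IsGoodWord [0] :=
  ⟨⟨rfl, fun i hi h1 => by simp at hi; omega⟩, fun a b c _ _ h => by simpa using h.length_le⟩

lemma tracksWord_zero : TracksWord [0] true [false] where
  ne_nil := by simp
  mem := by simp
  closed := by
    rintro i -
    refine ⟨fun h => by simp at h, ?_⟩
    rintro ⟨a, -, h⟩
    simpa using h.length_le
  not_bounding := by simp
  le_numAscents := by simp
  lt_of_growing := by simp
  not_bounding_of_growing := by
    rintro - b ⟨a, -, h⟩
    simpa using h.length_le
  numAscents_of_growing := by simp [numAscents]
  bounding := by simp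

/-- The number of ascent sequences of length `n` avoiding both patterns equals
the Catalan number $C_n$. -/
theorem catalan_count_avoid_0001_1012 (n : ℕ) (hn : 1 ≤ n) :
    avoiderCount n [[0,0,0,1], [1,0,1,2]] = catalan n := by
  obtain ⟨n, rfl⟩ := Nat.exists_eq_add_of_le' hn
  have hset : {w : List ℕ | w.length = n + 1 ∧ IsAscentSeq w ∧
      ∀ τ ∈ [[0,0,0,1], [1,0,1,2]], Avoids w τ} =
      ((avoidWords n (true, [false])).image (List.cons 0) : Finset (List ℕ)) := by
    ext w
    simp only [avoids_iff, Set.mem_ofPred_eq, Finset.coe_image, Set.mem_image, Finset.mem_coe,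
      mem_avoidWords tracksWord_zero isGoodWord_zero]
    constructor
    · rintro ⟨hlen, hw⟩
      obtain ⟨x, v, rfl⟩ := List.exists_cons_of_length_eq_add_one hlen
      obtain rfl : x = 0 := by simpa using hw.1.1
      exact ⟨v, ⟨by simpa using hlen, hw⟩, rfl⟩
    · rintro ⟨v, ⟨hlen, hv⟩, rfl⟩
      exact ⟨by simp [hlen], hv⟩
  rw [avoiderCount, hset, Set.ncard_coe_finset,
    Finset.card_image_of_injective _ List.cons_injective]
  have h := congrArg (PowerSeries.coeff (n + 1)) runValue.total_eq_catalan
  rw [runValue.total, runValue, PowerSeries.coeff_mk, PowerSeries.coeff_mk, runCoeff] at h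
  have hc := card_avoidWords n (true, [false])
  simp [avoidMoves, PowerSeries.coeff_one] at h
  exact_mod_cast hc.trans h
end

section
/- For every integer n ≥ 1, the number of ascent sequences of length n that avoid both of the patterns 0021 and 0121 equals the Catalan number C_n = (1/(n+1))·binom(2n,n). -/
theorem numAscents_cons_cons (a b : ℕ) (w : List ℕ) :
    numAscents (a :: b :: w) = numAscents (b :: w) + if a < b then 1 else 0 := by
  simp [numAscents, List.countP_cons]

theorem numAscents_concat {p : List ℕ} {l : ℕ} (x : ℕ) (hl : p.getLast? = some l) :
    numAscents (p ++ [x]) = numAscents p + if l < x then 1 else 0 := by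
  induction p with
  | nil => simp at hl
  | cons a p ih =>
    cases p with
    | nil =>
      obtain rfl : a = l := by simpa using hl
      simp [numAscents, List.countP_cons]
    | cons b q =>
      have := ih (by simpa using hl)
      simp only [List.cons_append, numAscents_cons_cons] at this ⊢
      omega

theorem numAscents_take_succ {w : List ℕ} {i : ℕ} (h : i + 1 < w.length) :
    numAscents (w.take (i + 2)) = numAscents (w.take (i + 1)) + if w[i] < w[i + 1] then 1 else 0 := by
  rw [List.take_succ_eq_append_getElem h]
  exact numAscents_concat _ (by simp [List.getLast?_take, List.getElem?_eq_getElem (by omega : i < w.length)])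

theorem contains_0021 {w : List ℕ} {i₀ i₁ i₂ i₃ : ℕ} (h₃ : i₃ < w.length) (h₀₁ : i₀ < i₁)
    (h₁₂ : i₁ < i₂) (h₂₃ : i₂ < i₃) (e : w[i₀] = w[i₁]) (lt₁ : w[i₁] < w[i₃])
    (lt₂ : w[i₃] < w[i₂]) : Contains w [0, 0, 2, 1] := by
  refine ⟨(![⟨i₀, by omega⟩, ⟨i₁, by omega⟩, ⟨i₂, by omega⟩, ⟨i₃, h₃⟩] : Fin 4 → Fin w.length),
    ?_, ?_⟩
  · refine Fin.strictMono_iff_lt_succ.2 fun i => ?_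
    fin_cases i <;> simp [*]
  · intro i j
    fin_cases i <;> fin_cases j <;> simp <;> omega

theorem contains_0121 {w : List ℕ} {i₀ i₁ i₂ i₃ : ℕ} (h₃ : i₃ < w.length) (h₀₁ : i₀ < i₁)
    (h₁₂ : i₁ < i₂) (h₂₃ : i₂ < i₃) (e : w[i₁] = w[i₃]) (lt₁ : w[i₀] < w[i₁])
    (lt₂ : w[i₁] < w[i₂]) : Contains w [0, 1, 2, 1] := by
  refine ⟨(![⟨i₀, by omega⟩, ⟨i₁, by omega⟩, ⟨i₂, by omega⟩, ⟨i₃, h₃⟩] : Fin 4 → Fin w.length),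
    ?_, ?_⟩
  · refine Fin.strictMono_iff_lt_succ.2 fun i => ?_
    fin_cases i <;> simp [*]
  · intro i j
    fin_cases i <;> fin_cases j <;> simp <;> omega

/-- The nonzero letters of `w` are weakly increasing. -/
def NonzeroMonotone (w : List ℕ) : Prop :=
  ∀ i j (hj : j < w.length) (hij : i < j), w[j] = 0 ∨ w[i] ≤ w[j]

theorem NonzeroMonotone.not_contains {w : List ℕ} (hw : NonzeroMonotone w) (a b : ℕ) :
    ¬ Contains w [0, a, b + 2, b + 1] := by
  rintro ⟨f, hf, hc⟩
  have h₂ : 2 < [0, a, b + 2, b + 1].length := by simp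
  have h₃ : 3 < [0, a, b + 2, b + 1].length := by simp
  have h₀ : 0 < [0, a, b + 2, b + 1].length := by simp
  have hlt : f ⟨2, h₂⟩ < f ⟨3, h₃⟩ := hf (by simp)
  have hgt := (hc ⟨2, h₂⟩ ⟨3, h₃⟩).2.2 (by simp)
  have hpos := (hc ⟨0, h₀⟩ ⟨3, h₃⟩).1.2 (by simp)
  rcases hw (f ⟨2, h₂⟩) (f ⟨3, h₃⟩) (f ⟨3, h₃⟩).2 hlt with h | h
  · exact (Nat.zero_le _).not_gt (hpos.trans_eq h)
  · exact h.not_gt hgt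

theorem IsAscentSeq.getElem_zero {w : List ℕ} (hw : IsAscentSeq w) (h : 0 < w.length) :
    w[0] = 0 := by
  have := hw.1
  rw [List.head?_eq_getElem?, List.getElem?_eq_getElem h] at this
  simpa using this

/-- A prefix of an ascent sequence that is weakly increasing does not skip any value. -/
theorem IsAscentSeq.exists_getElem_eq {w : List ℕ} (hw : IsAscentSeq w) {i : ℕ} (hi : i < w.length)
    (hmono : ∀ k (hk : k < i), w[k] ≤ w[k + 1]) :
    numAscents (w.take (i + 1)) = w[i] ∧
      ∀ v ≤ w[i], ∃ k, ∃ hk : k ≤ i, w[k] = v := by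
  induction i with
  | zero =>
    have h0 := hw.getElem_zero hi
    constructor
    · rw [List.take_succ_eq_append_getElem hi, h0]
      simp [numAscents]
    · intro v hv
      exact ⟨0, le_rfl, by omega⟩
  | succ i ih =>
    obtain ⟨ih₁, ih₂⟩ := ih (by omega) (fun k hk => hmono k (by omega))
    have hle := hw.2 (i + 1) hi (by omega)
    have hge := hmono i (by omega)
    rw [List.get_eq_getElem] at hle
    simp only [] at hle
    rw [ih₁] at hle
    constructor
    · rw [numAscents_take_succ hi, ih₁]
      split_ifs <;> omega
    · intro v hv
      rcases Nat.lt_or_ge w[i] v with h | h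
      · exact ⟨i + 1, le_rfl, by omega⟩
      · obtain ⟨k, hk, e⟩ := ih₂ v h
        exact ⟨k, by omega, e⟩

theorem IsAscentSeq.nonzeroMonotone {w : List ℕ} (hw : IsAscentSeq w)
    (h₁ : Avoids w [0, 0, 2, 1]) (h₂ : Avoids w [0, 1, 2, 1]) : NonzeroMonotone w := by
  intro i j
  induction j using Nat.strong_induction_on generalizing i with
  | _ j ih =>
  intro hj hij
  by_contra! hcon
  obtain ⟨hpos, hlt⟩ := hcon
  have hz := hw.getElem_zero (by omega)
  have hnz : ∀ k (hk : k < i), 0 < k → w[k] ≠ 0 := fun k hk hk0 hwk =>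
    h₁ (contains_0021 hj hk0 hk hij (by omega) (by omega) hlt)
  have hmono : ∀ k (hk : k < i), w[k] ≤ w[k + 1] := by
    intro k hk
    rcases ih (k + 1) (by omega) k (by omega) (by omega) with h | h
    · rcases Nat.lt_or_ge (k + 1) i with hki | hki
      · exact absurd h (hnz _ hki (by omega))
      · obtain rfl : k + 1 = i := by omega
        omega
    · exact h
  obtain ⟨k, hk, e⟩ := (hw.exists_getElem_eq (by omega) hmono).2 w[j] hlt.le
  have hki : k ≠ i := by rintro rfl; omega
  have hk0 : k ≠ 0 := by rintro rfl; omega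
  exact h₂ (contains_0121 (i₀ := 0) hj (by omega) (by omega : k < i) hij e (by omega) (by omega))

/-- The words `t` of length `n` extending a word with `a` ascents, with last letter `l` and with
largest letter `m` (or `m = 1` if it is zero), to an ascent sequence whose further nonzero
letters increase weakly from `m` on. -/
def extensions : ℕ → ℕ → ℕ → ℕ → Finset (List ℕ)
  | 0, _, _, _ => {[]}
  | n + 1, a, m, l => ((Finset.range (a + 2)).filter fun x => x = 0 ∨ m ≤ x).biUnion fun x =>
      (extensions n (a + if l < x then 1 else 0) (max m x) x).image (List.cons x)

theorem mem_extensions_iff {n a m l : ℕ} {p t : List ℕ} (hp : p.getLast? = some l)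
    (ha : numAscents p = a) (hm : 1 ≤ m) (hmp : ∀ x, 1 ≤ x → (m ≤ x ↔ ∀ y ∈ p, y ≤ x)) :
    t ∈ extensions n a m l ↔ t.length = n ∧ ∀ i (hi : i < t.length),
      t[i] ≤ numAscents (p ++ t.take i) + 1 ∧ (t[i] = 0 ∨ ∀ y ∈ p ++ t.take i, y ≤ t[i]) := by
  induction n generalizing a m l p t with
  | zero =>
    simp only [extensions, Finset.mem_singleton, List.length_eq_zero_iff]
    constructor
    · rintro rfl; simp
    · exact fun h => h.1
  | succ n ih =>
    cases t with
    | nil => simp [extensions]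
    | cons x t =>
      have key := @ih (a + if l < x then 1 else 0) (max m x) x (p ++ [x]) t (by simp)
        (by rw [numAscents_concat x hp, ha]) (by omega) (by
          intro z hz
          have := hmp z hz
          simp only [List.mem_append, List.mem_singleton, max_le_iff, or_imp, forall_and, this,
            forall_eq])
      have h₁ : (x :: t) ∈ extensions (n + 1) a m l ↔
          (x < a + 2 ∧ (x = 0 ∨ m ≤ x)) ∧
            t ∈ extensions n (a + if l < x then 1 else 0) (max m x) x := by
        simp only [extensions, Finset.mem_biUnion, Finset.mem_filter, Finset.mem_range,
          Finset.mem_image, List.cons.injEq]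
        constructor
        · rintro ⟨y, hy, s, hs, rfl, rfl⟩
          exact ⟨hy, hs⟩
        · rintro ⟨hx, ht⟩
          exact ⟨x, hx, t, ht, rfl, rfl⟩
      have h₂ : (x = 0 ∨ m ≤ x) ↔ (x = 0 ∨ ∀ y ∈ p, y ≤ x) := by
        rcases Nat.eq_zero_or_pos x with h | h
        · simp [h]
        · rw [hmp x h]
      rw [h₁, key, h₂]
      constructor
      · rintro ⟨⟨hx, hx'⟩, hlen, hall⟩
        refine ⟨by simp [hlen], ?_⟩
        rintro (_ | i) hi
        · simpa [ha] using ⟨by omega, hx'⟩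
        · simpa using hall i (by simpa using hi)
      · rintro ⟨hlen, hall⟩
        refine ⟨?_, by simpa using hlen, ?_⟩
        · have := hall 0 (by simp)
          simp [ha] at this
          exact ⟨by omega, this.2⟩
        · intro i hi
          simpa using hall (i + 1) (Nat.succ_lt_succ hi)

theorem card_extensions_succ (n a m l : ℕ) : (extensions (n + 1) a m l).card =
    ∑ x ∈ (Finset.range (a + 2)).filter (fun x => x = 0 ∨ m ≤ x),
      (extensions n (a + if l < x then 1 else 0) (max m x) x).card := by
  rw [extensions, Finset.card_biUnion]
  · exact Finset.sum_congr rfl fun x _ =>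
      Finset.card_image_of_injective _ (List.cons_injective)
  · intro x _ y _ hxy
    refine Finset.disjoint_left.2 fun t ht ht' => hxy ?_
    obtain ⟨s, -, rfl⟩ := Finset.mem_image.1 ht
    obtain ⟨s', -, h⟩ := Finset.mem_image.1 ht'
    exact (List.cons.inj h).1.symm

theorem card_extensions_succ' (n m d l : ℕ) : (extensions (n + 1) (m + d) (m + 1) l).card =
    (extensions n (m + d) (m + 1) 0).card + ∑ k ∈ Finset.range (d + 1),
      (extensions n (m + d + if l < m + 1 + k then 1 else 0) (m + 1 + k) (m + 1 + k)).card := by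
  have hset : (Finset.range (m + d + 2)).filter (fun x => x = 0 ∨ m + 1 ≤ x) =
      insert 0 ((Finset.range (d + 1)).map (addLeftEmbedding (m + 1))) := by
    ext x
    simp only [Finset.mem_filter, Finset.mem_range, Finset.mem_insert, Finset.mem_map,
      addLeftEmbedding_apply]
    constructor
    · rintro ⟨h, h' | h'⟩
      · exact Or.inl h'
      · exact Or.inr ⟨x - (m + 1), by omega, by omega⟩
    · rintro (rfl | ⟨k, hk, rfl⟩) <;> omega
  rw [card_extensions_succ, hset, Finset.sum_insert (by simp), Finset.sum_map]
  simp

section GeneratingFunctions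

open PowerSeries

variable {S : Type*} [CommRing S] {x c g : S}

theorem geometric_catalan_recurrence (hc : c ^ 2 * x + 1 = c) (hg : g * (1 - x) = 1) (d : ℕ) :
    g * c * ((1 - x) * c ^ 2) ^ d = 1 + x * (c ^ 2 * ((1 - x) * c ^ 2) ^ d +
      (∑ k ∈ Finset.range d, g * c * ((1 - x) * c ^ 2) ^ (k + 1) +
        g * c * ((1 - x) * c ^ 2) ^ d)) := by
  induction d with
  | zero =>
    simp only [pow_zero, Finset.range_zero, Finset.sum_empty]
    linear_combination c * hg - hc
  | succ d ih =>
    rw [Finset.sum_range_succ]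
    simp only [pow_succ _ d] at ih ⊢
    generalize ((1 - x) * c ^ 2) ^ d = p at ih ⊢
    linear_combination ih + (c ^ 3 * p * (1 - 2 * x) - c * p) * hg +
      p * c * (-c + x * c - 1) * hc

theorem sq_catalan_recurrence (hc : c ^ 2 * x + 1 = c) (hg : g * (1 - x) = 1) (d : ℕ) :
    c ^ 2 * ((1 - x) * c ^ 2) ^ d = 1 + x * (c ^ 2 * ((1 - x) * c ^ 2) ^ d +
      ∑ k ∈ Finset.range (d + 1), g * c * ((1 - x) * c ^ 2) ^ (k + 1)) := by
  have h := geometric_catalan_recurrence hc hg d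
  rw [Finset.sum_range_succ]
  simp only [pow_succ _ d]
  linear_combination h - (c + x * c ^ 3) * ((1 - x) * c ^ 2) ^ d * hg -
    c * ((1 - x) * c ^ 2) ^ d * hc

/-- The extensions after a last letter `0`, respectively after a last letter that is the largest
so far, are counted by `C ^ 2 * ((1 - X) * C ^ 2) ^ d` and `C / (1 - X) * ((1 - X) * C ^ 2) ^ d`,
where `C` is the Catalan series and `d` measures how far the largest letter is below its bound. -/
theorem card_extensions {c g : ℤ⟦X⟧} (hc : c ^ 2 * X + 1 = c) (hg : g * (1 - X) = 1) (n : ℕ) :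
    ∀ m d, ((extensions n (m + d) (m + 1) 0).card : ℤ) =
        coeff n (c ^ 2 * ((1 - X) * c ^ 2) ^ d) ∧
      ((extensions n (m + d) (m + 1) (m + 1)).card : ℤ) =
        coeff n (g * c * ((1 - X) * c ^ 2) ^ d) := by
  induction n with
  | zero =>
    intro m d
    rw [sq_catalan_recurrence hc hg, geometric_catalan_recurrence hc hg]
    simp [extensions]
  | succ n ih =>
    intro m d
    rw [sq_catalan_recurrence hc hg, geometric_catalan_recurrence hc hg, card_extensions_succ',
      card_extensions_succ']
    simp only [map_add, coeff_succ_X_mul, coeff_one, Nat.succ_ne_zero, if_false, zero_add,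
      map_sum, Nat.cast_add, Nat.cast_sum, (ih m d).1]
    refine ⟨congrArg _ ?_, congrArg _ ?_⟩
    · rw [← Finset.sum_range_reflect]
      refine Finset.sum_congr rfl fun k hk => ?_
      have hk := Finset.mem_range.1 hk
      rw [if_pos (by omega), ← (ih (m + (d + 1 - 1 - k)) (k + 1)).2]
      congr 3 <;> omega
    · rw [Finset.sum_range_succ', ← Finset.sum_range_reflect]
      congr 1
      · refine Finset.sum_congr rfl fun k hk => ?_
        have hk := Finset.mem_range.1 hk
        rw [if_pos (by omega), ← (ih (m + (d - 1 - k + 1)) (k + 1)).2]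
        congr 3 <;> omega
      · simpa using (ih m d).2

theorem card_extensions_zero_one_zero (n : ℕ) : (extensions n 0 1 0).card = catalan (n + 1) := by
  have hc : (map (Nat.castRingHom ℤ) catalanSeries) ^ 2 * X + 1 =
      map (Nat.castRingHom ℤ) catalanSeries := by
    simpa using congrArg (map (Nat.castRingHom ℤ)) catalanSeries_sq_mul_X_add_one
  have h := (card_extensions hc (mk_one_mul_one_sub_eq_one ℤ) n 0 0).1
  have h' := congrArg (coeff (n + 1)) hc
  simp only [map_add, coeff_succ_mul_X, coeff_one, coeff_map, catalanSeries_coeff] at h'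
  simp only [pow_zero, mul_one] at h
  rw [← h] at h'
  simpa using h'

end GeneratingFunctions

theorem mem_extensions_zero_one_zero_iff {n : ℕ} {t : List ℕ} :
    t ∈ extensions n 0 1 0 ↔
      t.length = n ∧ IsAscentSeq (0 :: t) ∧ NonzeroMonotone (0 :: t) := by
  rw [mem_extensions_iff (p := [0]) (by simp) (by simp [numAscents]) le_rfl (by simp)]
  refine and_congr_right fun _ => ⟨fun h => ⟨⟨by simp, ?_⟩, ?_⟩, ?_⟩
  · rintro (_ | i) hi hi'
    · omega
    · simpa using (h i (by simpa using hi)).1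
  · rintro i (_ | j) hj hij
    · omega
    · refine (h j (by simpa using hj)).2.imp (by simp) fun h' => h' _ ?_
      have : (0 :: t)[i] = ([0] ++ t.take j)[i]'(by simp at hj ⊢; omega) := by
        cases i <;> simp
      rw [this]
      exact List.getElem_mem _
  · rintro ⟨h₁, h₂⟩ i hi
    refine ⟨by simpa using h₁.2 (i + 1) (by simpa using hi) (by omega), ?_⟩
    rw [or_iff_not_imp_left]
    intro h0 y hy
    obtain ⟨k, hk, rfl⟩ := List.getElem_of_mem hy
    have hk' : k < i + 1 := by simp at hk; omega
    have := (h₂ k (i + 1) (by simpa using hi) hk').resolve_left (by simpa using h0)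
    have e : (0 :: t)[k]'(by simp; omega) = ([0] ++ t.take i)[k] := by
      cases k <;> simp
    rw [← e]
    simpa using this

/-- The number of ascent sequences of length `n` avoiding both patterns equals
the Catalan number $C_n$. -/
theorem catalan_count_avoid_0021_0121 (n : ℕ) (hn : 1 ≤ n) :
    avoiderCount n [[0,0,2,1], [0,1,2,1]] = catalan n := by
  obtain ⟨n, rfl⟩ : ∃ k, n = k + 1 := ⟨n - 1, by omega⟩
  have hset : {w : List ℕ | w.length = n + 1 ∧ IsAscentSeq w ∧
      ∀ τ ∈ [[0, 0, 2, 1], [0, 1, 2, 1]], Avoids w τ} =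
      ((extensions n 0 1 0).image (List.cons 0) : Finset (List ℕ)) := by
    ext w
    simp only [Set.mem_ofPred_eq, List.forall_mem_cons, List.not_mem_nil, IsEmpty.forall_iff,
      implies_true, and_true, Finset.coe_image, Set.mem_image, Finset.mem_coe,
      mem_extensions_zero_one_zero_iff]
    constructor
    · rintro ⟨hlen, hw, h₁, h₂⟩
      obtain ⟨t, rfl⟩ : ∃ t, w = 0 :: t := List.head?_eq_some_iff.1 hw.1
      exact ⟨t, ⟨by simpa using hlen, hw, hw.nonzeroMonotone h₁ h₂⟩, rfl⟩
    · rintro ⟨t, ⟨hlen, hw, hmono⟩, rfl⟩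
      exact ⟨by simpa using hlen, hw, hmono.not_contains 0 0, hmono.not_contains 1 0⟩
  rw [avoiderCount, hset, Set.ncard_coe_finset,
    Finset.card_image_of_injective _ List.cons_injective, card_extensions_zero_one_zero]
end
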